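/- arXiv:1907.02574 — 5 statements merged into one kernel-verified Lean document; each statement's English description precedes it below -/
import Mathlib

section
/- Let M be a monoid such that Fix(M) := {m' ∈ M | ∀ m ∈ M, m'·m = m'} is nonempty, and let X := {x_{m'} | m' ∈ Fix(M)} carry the right M-action x_{m'}·m := x_{m'm}. Then the category of reflexive (X,M)-graphs, i.e. the category of presheaves on the reflexive theory r𝔾_{(X,M)}, is equivalent to the category of presheaves on the one-object category BM whose endomorphism monoid is M (equivalently, to the category of right M-sets). -/
open CategoryTheory

/-- The set `Fix(M) = {m' ∈ M | ∀ m, m'·m = m'}` of fixed elements of a monoid `M`.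
It serves as the set `X = {x_{m'} | m' ∈ Fix(M)}` of the reflexive theory. -/
def FixE (M : Type) [Monoid M] : Type := {e : M // ∀ m : M, e * m = e}

/-- The two objects of the reflexive `(X,M)`-graph theory. -/
inductive RGObj : Type
  | V : RGObj
  | A : RGObj

variable (M : Type) [Monoid M]

/-- Hom-sets of the reflexive `(X,M)`-graph theory for `X = Fix(M)`:
`Hom(V,A) = X`, `Hom(A,A) = M`, `Hom(V,V) = {id_V}`, `Hom(A,V) = {ℓ}`. -/
@[reducible] def RGHom : RGObj → RGObj → Type
  | .V, .V => PUnit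
  | .V, .A => FixE M
  | .A, .V => PUnit
  | .A, .A => M

/-- Identities of the reflexive theory. -/
def rgid : ∀ a : RGObj, RGHom M a a
  | .V => PUnit.unit
  | .A => (1 : M)

/-- Composition in the reflexive `(X,M)`-graph theory: on `A`-endomorphisms it is
the monoid multiplication (`m ∘ m' = m'm`), an element `x_{m'} : V → A` composed
with `m : A → A` is the action `x_{m'}·m`, `ℓ ≫ x_{m'} = m'`, `x ≫ ℓ = id_V` and
`m ≫ ℓ = ℓ`. -/
def rgcomp : ∀ {a b c : RGObj}, RGHom M a b → RGHom M b c → RGHom M a c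
  | .V, .V, .V, _, _ => PUnit.unit
  | .V, .V, .A, _, g => g
  | .V, .A, .V, _, _ => PUnit.unit
  | .V, .A, .A, f, g => ⟨g * f.1, fun m => by rw [mul_assoc, f.2 m]⟩
  | .A, .V, .V, _, _ => PUnit.unit
  | .A, .V, .A, _, g => g.1
  | .A, .A, .V, _, _ => PUnit.unit
  | .A, .A, .A, f, g => g * f

/-- The reflexive `(X,M)`-graph theory `r𝔾_{(X,M)}` for `X = Fix(M)`. -/
def RGTheory (M : Type) [Monoid M] : Type := RGObj

instance : Category (RGTheory M) where
  Hom a b := RGHom M a b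
  id a := rgid M a
  comp f g := rgcomp M f g
  id_comp {a b} f := by
    cases a <;> cases b
    · rfl
    · rfl
    · rfl
    · exact mul_one f
  comp_id {a b} f := by
    cases a <;> cases b
    · rfl
    · exact Subtype.ext (one_mul f.1)
    · rfl
    · exact one_mul f
  assoc {a b c d} f g h := by
    cases a <;> cases b <;> cases c <;> cases d
    all_goals try rfl
    · exact Subtype.ext (h.2 f.1).symm
    · exact Subtype.ext (mul_assoc h g f.1).symm
    · exact (h.2 f).symm
    · exact (mul_assoc h g f).symm

namespace RGTheory

open Opposite

variable {M}

/-- The vertex object of the reflexive theory. -/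
def vert (M : Type) [Monoid M] : RGTheory M := RGObj.V

/-- The arc object of the reflexive theory. -/
def arc (M : Type) [Monoid M] : RGTheory M := RGObj.A

/-- The map `ℓ` from the arc object to the vertex object. -/
def loop (M : Type) [Monoid M] : arc M ⟶ vert M := PUnit.unit

/-- The section of `ℓ` given by a fixed element. -/
def point (e : FixE M) : vert M ⟶ arc M := e

/-- The endomorphism of the arc object given by an element of the monoid. -/
def arcEnd (m : M) : arc M ⟶ arc M := m

lemma point_comp_loop (e : FixE M) : point e ≫ loop M = 𝟙 (vert M) := rfl

lemma loop_comp_point (e : FixE M) : loop M ≫ point e = arcEnd e.1 := rfl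

lemma point_comp_arcEnd (e f : FixE M) : point e ≫ arcEnd f.1 = point f :=
  Subtype.ext (f.2 e.1)

lemma arcEnd_comp_loop (m : M) : arcEnd m ≫ loop M = loop M := rfl

/-- The inclusion of `BM` as the full subcategory of the reflexive theory on the arc object. -/
def arcInclusion (M : Type) [Monoid M] : SingleObj M ⥤ RGTheory M where
  obj _ := arc M
  map m := arcEnd m
  map_id _ := rfl
  map_comp _ _ := rfl

/-- Restriction of a reflexive graph to its arcs, with the action of the monoid. -/
abbrev arcs (M : Type) [Monoid M] : ((RGTheory M)ᵒᵖ ⥤ Type) ⥤ ((SingleObj M)ᵒᵖ ⥤ Type) :=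
  (Functor.whiskeringLeft _ _ Type).obj (arcInclusion M).op

section Extension

variable (S : (SingleObj M)ᵒᵖ ⥤ Type)

/-- The right action of the monoid on the set underlying a presheaf on `BM`. -/
def act (m : M) (s : S.obj (op (SingleObj.star M))) : S.obj (op (SingleObj.star M)) :=
  S.map (Quiver.Hom.op (X := SingleObj.star M) (Y := SingleObj.star M) m) s

lemma act_one (s : S.obj (op (SingleObj.star M))) : act S 1 s = s :=
  ConcreteCategory.congr_hom (S.map_id (op (SingleObj.star M))) s

lemma act_mul (m n : M) (s : S.obj (op (SingleObj.star M))) :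
    act S (m * n) s = act S n (act S m s) :=
  ConcreteCategory.congr_hom (S.map_comp
    (Quiver.Hom.op (X := SingleObj.star M) (Y := SingleObj.star M) m)
    (Quiver.Hom.op (X := SingleObj.star M) (Y := SingleObj.star M) n)) s

lemma act_act_fix (e : FixE M) (m : M) (s : S.obj (op (SingleObj.star M))) :
    act S m (act S e.1 s) = act S e.1 s := by
  rw [← act_mul, e.2]

/-- The vertices and arcs of the reflexive graph extending a right `M`-set: the vertices are the
elements fixed by the action. -/
def ExtObj : RGObj → Type
  | .V => {s : S.obj (op (SingleObj.star M)) // ∀ m : M, act S m s = s}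
  | .A => S.obj (op (SingleObj.star M))

/-- The action of the reflexive theory on the extension of a right `M`-set. -/
def extMap : ∀ {a b : RGObj}, RGHom M a b → ExtObj S b → ExtObj S a
  | .V, .V, _, s => s
  | .V, .A, e, s => ⟨act S e.1 s, fun m => act_act_fix S e m s⟩
  | .A, .V, _, s => s.1
  | .A, .A, m, s => act S m s

lemma extMap_id (a : RGObj) (s : ExtObj S a) : extMap S (rgid M a) s = s := by
  cases a
  · rfl
  · exact act_one S s

lemma extMap_comp {a b c : RGObj} (f : RGHom M a b) (g : RGHom M b c) (s : ExtObj S c) :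
    extMap S (rgcomp M f g) s = extMap S f (extMap S g s) := by
  cases a <;> cases b <;> cases c
  · rfl
  · rfl
  · exact Subtype.ext (s.2 f.1).symm
  · exact Subtype.ext (act_mul S g f.1 s)
  · rfl
  · rfl
  · exact (s.2 _).symm
  · exact act_mul S g f s

/-- The reflexive graph extending a right `M`-set. -/
def extension : (RGTheory M)ᵒᵖ ⥤ Type where
  obj a := ExtObj S a.unop
  map f := ↾(extMap S f.unop)
  map_id a := by
    ext s
    exact extMap_id S a.unop s
  map_comp f g := by
    ext s
    exact extMap_comp S g.unop f.unop s

/-- The arcs of the extension of a right `M`-set form the given `M`-set. -/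
def arcsExtensionIso : (arcs M).obj (extension S) ≅ S :=
  NatIso.ofComponents (fun _ => Iso.refl _) (fun _ => rfl)

end Extension

instance : (arcs M).EssSurj where
  mem_essImage S := ⟨extension S, ⟨arcsExtensionIso S⟩⟩

lemma arcs_faithful (e : FixE M) : (arcs M).Faithful where
  map_injective {P Q} α β h := by
    have hA : α.app (op (arc M)) = β.app (op (arc M)) :=
      NatTrans.congr_app h (op (SingleObj.star M))
    have split (R : (RGTheory M)ᵒᵖ ⥤ Type) : R.map (loop M).op ≫ R.map (point e).op = 𝟙 _ := by
      rw [← R.map_comp, ← op_comp, point_comp_loop, op_id, R.map_id]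
    ext1
    funext a
    induction a with | op a
    cases a
    · calc α.app (op (vert M))
          = P.map (loop M).op ≫ α.app (op (arc M)) ≫ Q.map (point e).op := by
            rw [α.naturality_assoc, split, Category.comp_id]
        _ = β.app (op (vert M)) := by
            rw [hA, β.naturality_assoc, split, Category.comp_id]
    · exact hA

lemma arcs_full (e : FixE M) : (arcs M).Full where
  map_surjective {P Q} β := by
    let b : P.obj (op (arc M)) ⟶ Q.obj (op (arc M)) := β.app (op (SingleObj.star M))
    have hb (m : M) : P.map (arcEnd m).op ≫ b = b ≫ Q.map (arcEnd m).op :=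
      β.naturality (Quiver.Hom.op (X := SingleObj.star M) (Y := SingleObj.star M) m)
    have hpoint (f : FixE M) :
        P.map (point f).op ≫ P.map (loop M).op ≫ b ≫ Q.map (point e).op =
          b ≫ Q.map (point f).op := by
      rw [← P.map_comp_assoc, ← op_comp, loop_comp_point, reassoc_of% hb f.1, ← Q.map_comp,
        ← op_comp, point_comp_arcEnd]
    have hloop : P.map (loop M).op ≫ b =
        (P.map (loop M).op ≫ b ≫ Q.map (point e).op) ≫ Q.map (loop M).op := by
      rw [Category.assoc, Category.assoc, ← Q.map_comp, ← op_comp, loop_comp_point, ← hb,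
        ← P.map_comp_assoc, ← op_comp, arcEnd_comp_loop]
    have hvert (k : P.obj (op (vert M)) ⟶ Q.obj (op (vert M))) :
        P.map (𝟙 (vert M)).op ≫ k = k ≫ Q.map (𝟙 (vert M)).op := by
      rw [op_id, P.map_id, Q.map_id, Category.id_comp, Category.comp_id]
    let γ : ∀ a : RGObj, P.obj (op (a : RGTheory M)) ⟶ Q.obj (op (a : RGTheory M))
      | .V => P.map (loop M).op ≫ b ≫ Q.map (point e).op
      | .A => b
    have hγ {a c : RGTheory M} (f : a ⟶ c) : P.map f.op ≫ γ a = γ c ≫ Q.map f.op := by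
      cases a <;> cases c
      · exact hvert _
      · exact hpoint f
      · exact hloop
      · exact hb f
    refine ⟨{ app := fun a => γ a.unop, naturality := fun _ _ f => hγ f.unop }, ?_⟩
    ext1
    rfl

end RGTheory

/-- For a monoid `M` with `Fix(M)` nonempty, the category of
reflexive `(X,M)`-graphs (presheaves on the reflexive theory, where
`X = {x_{m'} | m' ∈ Fix(M)}`) is equivalent to the category of presheaves on the
one-object category `BM` with endomorphism monoid `M` (i.e. to right `M`-sets). -/
theorem reflexive_xmgraphs_equiv_presheaves_on_BM
    (M : Type) [Monoid M] (hFix : Nonempty (FixE M)) :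
    Nonempty (((RGTheory M)ᵒᵖ ⥤ Type) ≌ ((SingleObj M)ᵒᵖ ⥤ Type)) := by
  obtain ⟨e⟩ := hFix
  have := RGTheory.arcs_faithful e
  have := RGTheory.arcs_full e
  have : (RGTheory.arcs M).IsEquivalence := {}
  exact ⟨(RGTheory.arcs M).asEquivalence⟩
end

section
/- Let X be a set. An oriented X-graph Q is an injective object in the category of oriented X-graphs if and only if Q(V) is nonempty and the parametrized incidence map ∂_Q : Q(A) → Q(V)^X is surjective, i.e. for every function f : X → Q(V) there is an arc α ∈ Q(A) with α.x = f(x) for all x ∈ X. -/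
open CategoryTheory

variable (X : Type)

/-- An oriented `X`-graph: a set of vertices, a set of arcs, and a parametrized
incidence map `∂ : A → V^X` (the `x`-incidence of an arc `a` is `inc a x`). -/
structure OGraph : Type 1 where
  V : Type
  A : Type
  inc : A → X → V

variable {X}

/-- Morphisms of oriented `X`-graphs: pairs of maps preserving the incidences. -/
@[ext]
structure OGHom (G H : OGraph X) where
  fV : G.V → H.V
  fA : G.A → H.A
  compat : ∀ a x, H.inc (fA a) x = fV (G.inc a x)

instance : Category (OGraph X) where
  Hom := OGHom
  id G := ⟨id, id, fun a x => rfl⟩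
  comp f g := ⟨g.fV ∘ f.fV, g.fA ∘ f.fA, fun a x => by
    simp [g.compat, f.compat]⟩
  id_comp f := rfl
  comp_id f := rfl
  assoc f g h := rfl

namespace OGraph

/-- The discrete graph on a set of vertices. -/
def discrete (X S : Type) : OGraph X := ⟨S, Empty, fun a => a.elim⟩

/-- The generic arc: the vertices are the elements of `X`, incident to a single arc. -/
def arc (X : Type) : OGraph X := ⟨X, Unit, fun _ x => x⟩

/-- A map on vertices, as a morphism out of the discrete graph. -/
def discreteHom {S : Type} {G : OGraph X} (v : S → G.V) : discrete X S ⟶ G :=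
  OGHom.mk (G := discrete X S) v Empty.elim (fun a => a.elim)

/-- The morphism out of the generic arc classifying an arc of `G`. -/
def arcHom {G : OGraph X} (a : G.A) : arc X ⟶ G :=
  OGHom.mk (G := arc X) (G.inc a) (fun _ => a) (fun _ _ => rfl)

theorem mono_of_injective {G H : OGraph X} (m : G ⟶ H)
    (hV : Function.Injective m.fV) (hA : Function.Injective m.fA) : Mono m where
  right_cancellation _ _ e :=
    OGHom.ext (hV.comp_left (congrArg OGHom.fV e)) (hA.comp_left (congrArg OGHom.fA e))

theorem injective_fV {G H : OGraph X} (m : G ⟶ H) [Mono m] : Function.Injective m.fV := by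
  intro u v e
  have key : discreteHom (fun _ : Unit => u) = discreteHom (fun _ : Unit => v) := by
    rw [← cancel_mono m]
    exact OGHom.ext (funext fun _ => e) (funext fun a => a.elim)
  exact congrFun (congrArg OGHom.fV key) ()

theorem injective_fA {G H : OGraph X} (m : G ⟶ H) [Mono m] : Function.Injective m.fA := by
  intro a b e
  have key : arcHom a = arcHom b := by
    rw [← cancel_mono m]
    exact OGHom.ext
      (funext fun x => by
        exact (m.compat a x).symm.trans ((congrArg (H.inc · x) e).trans (m.compat b x)))
      (funext fun _ => e)
  exact congrFun (congrArg OGHom.fA key) ()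

theorem mono_discreteHom {S : Type} {G : OGraph X} {v : S → G.V} (hv : Function.Injective v) :
    Mono (discreteHom v) :=
  mono_of_injective _ hv fun a => a.elim

theorem nonempty_of_injective (Q : OGraph X) [Injective Q] : Nonempty Q.V := by
  let m : discrete X Empty ⟶ discrete X Unit := discreteHom (G := discrete X Unit) Empty.elim
  have : Mono m := mono_discreteHom (G := discrete X Unit) fun a => a.elim
  exact ⟨(Injective.factorThru (discreteHom (G := Q) Empty.elim) m).fV ()⟩

theorem exists_arc_of_injective (Q : OGraph X) [Injective Q] (f : X → Q.V) :
    ∃ a : Q.A, ∀ x : X, Q.inc a x = f x := by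
  let m : discrete X X ⟶ arc X := discreteHom (G := arc X) id
  have : Mono m := mono_discreteHom (G := arc X) Function.injective_id
  let h := Injective.factorThru (discreteHom f) m
  refine ⟨h.fA (), fun x => (h.compat () x).trans ?_⟩
  exact congrFun (congrArg OGHom.fV (Injective.comp_factorThru (discreteHom f) m)) x

theorem injective_of_surjective_inc (Q : OGraph X) [Nonempty Q.V]
    (hQ : ∀ f : X → Q.V, ∃ a : Q.A, ∀ x : X, Q.inc a x = f x) : Injective Q where
  factors {G H} g m _ := by
    choose s hs using hQ
    have mV := injective_fV m
    have mA := injective_fA m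
    let hV : H.V → Q.V := Function.extend m.fV g.fV fun _ => Classical.arbitrary Q.V
    let hA : H.A → Q.A := Function.extend m.fA g.fA fun b => s fun x => hV (H.inc b x)
    have eV : ∀ u, hV (m.fV u) = g.fV u := fun u => mV.extend_apply _ _ u
    have eA : ∀ a, hA (m.fA a) = g.fA a := fun a => mA.extend_apply _ _ a
    refine ⟨OGHom.mk hV hA fun b x => ?_, OGHom.ext (funext eV) (funext eA)⟩
    by_cases hb : ∃ a, m.fA a = b
    · obtain ⟨a, rfl⟩ := hb
      rw [eA, m.compat, eV, g.compat]
    · simp only [hA, Function.extend_apply' _ _ _ hb, hs]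

end OGraph

/-- An oriented `X`-graph `Q` is an injective object iff `Q(V)` is
nonempty and the parametrized incidence map `∂_Q : Q(A) → Q(V)^X` is surjective. -/
theorem ographs_injective_iff (X : Type) (Q : OGraph X) :
    Injective Q ↔
      Nonempty Q.V ∧ ∀ f : X → Q.V, ∃ a : Q.A, ∀ x : X, Q.inc a x = f x := by
  constructor
  · intro _
    exact ⟨Q.nonempty_of_injective, Q.exists_arc_of_injective⟩
  · rintro ⟨_, hQ⟩
    exact Q.injective_of_surjective_inc hQ
end

section
/- Let M be a group and X a right M-set. An (X,M)-graph P (a presheaf on 𝔾_{(X,M)}) is a projective object in the category of (X,M)-graphs if and only if P is isomorphic to a coproduct of representable presheaves, i.e. to a coproduct of copies of y(V) and y(A) where y is the Yoneda embedding of 𝔾_{(X,M)}. -/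
open CategoryTheory

/-- The two objects of the `(X,M)`-graph theory: a vertex object and an arc object. -/
inductive GObj : Type
  | V : GObj
  | A : GObj

/-- A right action of a monoid `M` on a set `X`. -/
structure RAction (M X : Type) [Monoid M] where
  act : X → M → X
  act_one : ∀ x, act x 1 = x
  act_mul : ∀ x m m', act (act x m) m' = act x (m * m')

variable (M X : Type) [Monoid M]

/-- Hom-sets of the `(X,M)`-graph theory: `Hom(V,A) = X`, `Hom(A,A) = M`,
`Hom(V,V) = {id}`, `Hom(A,V) = ∅`. -/
@[reducible] def GHom : GObj → GObj → Type
  | .V, .V => PUnit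
  | .V, .A => X
  | .A, .V => PEmpty
  | .A, .A => M

/-- Identities of the `(X,M)`-graph theory. -/
def gid : ∀ a : GObj, GHom M X a a
  | .V => PUnit.unit
  | .A => (1 : M)

variable {M X}

/-- Composition in the `(X,M)`-graph theory: `x ≫ m = x·m` (the right action) and
`m ≫ m' = m * m'`. -/
def gcomp (ρ : RAction M X) :
    ∀ {a b c : GObj}, GHom M X a b → GHom M X b c → GHom M X a c
  | .V, .V, .V, _, _ => PUnit.unit
  | .V, .V, .A, _, g => g
  | .V, .A, .V, _, g => g.elim
  | .V, .A, .A, f, g => ρ.act f g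
  | .A, .V, _, f, _ => f.elim
  | .A, .A, .V, _, g => g.elim
  | .A, .A, .A, f, g => f * g

variable (M X)

/-- The `(X,M)`-graph theory `𝔾_{(X,M)}` associated to a right `M`-action on `X`. -/
def GTheory (_ρ : RAction M X) : Type := GObj

variable {M X}

instance GTheory.category (ρ : RAction M X) : Category (GTheory M X ρ) where
  Hom a b := GHom M X a b
  id a := gid M X a
  comp f g := gcomp ρ f g
  id_comp {a b} f := by
    cases a <;> cases b
    · rfl
    · rfl
    · exact f.elim
    · exact one_mul f
  comp_id {a b} f := by
    cases a <;> cases b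
    · rfl
    · exact ρ.act_one f
    · exact f.elim
    · exact mul_one f
  assoc {a b c d} f g h := by
    cases a <;> cases b <;> cases c <;> cases d
    all_goals first
      | rfl
      | exact f.elim
      | exact g.elim
      | exact h.elim
      | exact ρ.act_mul f g h
      | exact mul_assoc f g h

/-- The vertex object of the theory. -/
def theoryV (ρ : RAction M X) : GTheory M X ρ := GObj.V

/-- The arc object of the theory. -/
def theoryA (ρ : RAction M X) : GTheory M X ρ := GObj.A

section Presheaf

open Limits Opposite

universe u

/-- A presheaf map out of a representable is determined by an element, so it lifts along any
surjection: representable presheaves are projective. -/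
theorem projective_yoneda_obj {C : Type u} [SmallCategory C] (a : C) :
    Projective (yoneda.obj a) where
  factors f e _ := by
    have he : Function.Surjective (e.app (op a)) :=
      (epi_iff_surjective _).1 inferInstance
    obtain ⟨x, hx⟩ := he (yonedaEquiv f)
    refine ⟨yonedaEquiv.symm x, ?_⟩
    rw [yonedaEquiv_symm_naturality_right, hx, Equiv.symm_apply_apply]

/-- A map from a representable presheaf to a coproduct factors through one of the summands. -/
theorem exists_factor_sigma_of_yoneda {C : Type u} [SmallCategory C] {ι : Type u}
    (F : ι → Cᵒᵖ ⥤ Type u) (a : C) (g : yoneda.obj a ⟶ ∐ F) :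
    ∃ (j : ι) (f : yoneda.obj a ⟶ F j), f ≫ Sigma.ι F j = g := by
  obtain ⟨⟨j⟩, y, hy⟩ := Types.jointly_surjective_of_isColimit
    (isColimitOfPreserves ((evaluation _ _).obj (op a))
      (colimit.isColimit (Discrete.functor F))) (yonedaEquiv g)
  refine ⟨j, yonedaEquiv.symm y, yonedaEquiv.injective ?_⟩
  rw [yonedaEquiv_comp, Equiv.apply_symm_apply]
  exact hy

/-- If a projective presheaf `P` has a generating family of elements which is minimal, in the
sense that any relation between two generators is an isomorphism from a generator to itself, then
`P` is the coproduct of the corresponding representables. -/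
theorem nonempty_iso_sigma_yoneda_of_minimal_generators {C : Type u} [SmallCategory C]
    (P : Cᵒᵖ ⥤ Type u) [Projective P] {ι : Type u} (c : ι → C) (p : ∀ i, P.obj (op (c i)))
    (generates : ∀ (a : C) (x : P.obj (op a)), ∃ (i : ι) (f : a ⟶ c i), P.map f.op (p i) = x)
    (minimal : ∀ (i j : ι) (f : c i ⟶ c j), P.map f.op (p j) = p i → i = j ∧ IsIso f) :
    Nonempty (P ≅ ∐ fun i => yoneda.obj (c i)) := by
  let r (i : ι) : yoneda.obj (c i) ⟶ P := yonedaEquiv.symm (p i)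
  let π : (∐ fun i => yoneda.obj (c i)) ⟶ P := Sigma.desc r
  have hπ (i : ι) : Sigma.ι (fun i => yoneda.obj (c i)) i ≫ π = r i := Sigma.ι_desc _ _
  have : Epi π := by
    rw [NatTrans.epi_iff_epi_app]
    rintro ⟨a⟩
    rw [epi_iff_surjective]
    intro x
    obtain ⟨i, f, rfl⟩ := generates a x
    refine ⟨(Sigma.ι (fun i => yoneda.obj (c i)) i).app (op a) f, ?_⟩
    exact congrArg (fun t => t.app (op a) f) (hπ i)
  obtain ⟨σ, hσ⟩ := Projective.factors (𝟙 P) π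
  have key (i : ι) : ∃ h : yoneda.obj (c i) ⟶ P,
      h ≫ σ = Sigma.ι (fun i => yoneda.obj (c i)) i := by
    obtain ⟨j, t, ht⟩ := exists_factor_sigma_of_yoneda _ _ (r i ≫ σ)
    obtain ⟨f, rfl⟩ := yoneda.map_surjective t
    have hr : yoneda.map f ≫ r j = r i := by
      rw [← hπ j, ← Category.assoc, ht, Category.assoc, hσ, Category.comp_id]
    rw [yonedaEquiv_symm_naturality_left] at hr
    obtain ⟨rfl, _⟩ := minimal i j f (yonedaEquiv.symm.injective hr)
    refine ⟨yoneda.map (inv f) ≫ r i, ?_⟩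
    rw [Category.assoc, ← ht, ← Category.assoc, ← Functor.map_comp, IsIso.inv_hom_id,
      CategoryTheory.Functor.map_id, Category.id_comp]
  choose h hh using key
  have hdesc : Sigma.desc h ≫ σ = 𝟙 _ := Sigma.hom_ext _ _ fun i => by
    rw [Sigma.ι_desc_assoc, hh, Category.comp_id]
  have hinv : Sigma.desc h = π := by
    rw [← Category.comp_id (Sigma.desc h), ← hσ, ← Category.assoc, hdesc, Category.id_comp]
  exact ⟨⟨σ, π, hσ, hinv ▸ hdesc⟩⟩

end Presheaf

/-- When `M` is a group, every endomorphism of the arc object is invertible. -/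
theorem isIso_of_endo_theoryA {M X : Type} [Group M] (ρ : RAction M X)
    (m : theoryA ρ ⟶ theoryA ρ) : IsIso m :=
  ⟨Inv.inv (α := M) m, mul_inv_cancel (G := M) m, inv_mul_cancel (G := M) m⟩

/-- The orbit relation on the arcs of an `(X,M)`-graph, for `M` a group. -/
def arcSetoid {M X : Type} [Group M] (ρ : RAction M X) (P : (GTheory M X ρ)ᵒᵖ ⥤ Type) :
    Setoid (P.obj (.op (theoryA ρ))) where
  r a b := ∃ m : theoryA ρ ⟶ theoryA ρ, P.map m.op b = a
  iseqv :=
    { refl a := ⟨𝟙 _, by simp⟩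
      symm := by
        rintro a b ⟨m, rfl⟩
        have := isIso_of_endo_theoryA ρ m
        exact ⟨inv m, by rw [← Functor.map_comp_apply, ← op_comp, IsIso.inv_hom_id]; simp⟩
      trans := by
        rintro a b c ⟨m, rfl⟩ ⟨n, rfl⟩
        exact ⟨m ≫ n, by simp⟩ }

open Limits in
/-- For a group `M` and a right `M`-set `X`, an `(X,M)`-graph
(presheaf on `𝔾_{(X,M)}`) is projective iff it is isomorphic to a coproduct of
representable presheaves. -/
theorem xmgraph_projective_iff_coproduct_of_representables
    (M X : Type) [Group M] (ρ : RAction M X)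
    (P : (GTheory M X ρ)ᵒᵖ ⥤ Type) :
    Projective P ↔
      ∃ (ι : Type) (c : ι → GTheory M X ρ),
        Nonempty (P ≅ ∐ fun i => yoneda.obj (c i)) := by
  constructor
  · intro _
    let I := {v : P.obj (.op (theoryV ρ)) //
      ∀ (x : theoryV ρ ⟶ theoryA ρ) (a : P.obj (.op (theoryA ρ))), P.map x.op a ≠ v}
    let c : I ⊕ Quotient (arcSetoid ρ P) → GTheory M X ρ :=
      Sum.elim (fun _ => theoryV ρ) (fun _ => theoryA ρ)
    let p : ∀ i, P.obj (.op (c i)) := fun i => match i with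
      | .inl v => v.1
      | .inr q => q.out
    have arcs (a : P.obj (.op (theoryA ρ))) :
        ∃ (q : Quotient (arcSetoid ρ P)) (m : theoryA ρ ⟶ theoryA ρ), P.map m.op q.out = a :=
      ⟨_, (arcSetoid ρ P).symm (Quotient.mk_out (s := arcSetoid ρ P) a)⟩
    refine ⟨_, c, nonempty_iso_sigma_yoneda_of_minimal_generators P c p ?_ ?_⟩
    · rintro (_ | _) x
      · by_cases hx : ∃ (y : theoryV ρ ⟶ theoryA ρ) (a : P.obj (.op (theoryA ρ))),
          P.map y.op a = x
        · obtain ⟨y, a, rfl⟩ := hx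
          obtain ⟨q, m, rfl⟩ := arcs a
          exact ⟨.inr q, y ≫ m, Functor.map_comp_apply P m.op y.op q.out⟩
        · push Not at hx
          exact ⟨.inl ⟨x, hx⟩, 𝟙 (theoryV ρ), Functor.map_id_apply P _ x⟩
      · obtain ⟨q, m, hm⟩ := arcs x
        exact ⟨.inr q, m, hm⟩
    · rintro (v | q) (w | q') f hf
      · have hid : f = 𝟙 (theoryV ρ) := rfl
        subst hid
        have hwv : w.1 = v.1 := (Functor.map_id_apply P _ w.1).symm.trans hf
        exact ⟨congrArg Sum.inl (Subtype.ext hwv.symm), inferInstanceAs (IsIso (𝟙 (theoryV ρ)))⟩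
      · exact absurd hf (v.2 f _)
      · exact PEmpty.elim f
      · exact ⟨congrArg Sum.inr (Quotient.out_equiv_out.1 ⟨f, hf⟩), isIso_of_endo_theoryA ρ f⟩
  · rintro ⟨ι, c, ⟨e⟩⟩
    have (i : ι) : Projective (yoneda.obj (c i)) := projective_yoneda_obj (c i)
    exact Projective.of_iso e.symm inferInstance
end

section
/- Let M be a monoid and X a nonempty right M-set, and let J_¬¬ be the dense (double-negation) Grothendieck topology on the theory 𝔾_{(X,M)}: a sieve S on an object c is covering iff for every morphism f : d → c there exists a morphism g : e → d with f ∘ g ∈ S. Then an (X,M)-graph G is a separated presheaf for J_¬¬ (every compatible family on a covering sieve admits at most one amalgamation) if and only if the parametrized incidence map ∂_G : G(A) → G(V)^X, ∂_G(α)(x) = α.x, is injective, i.e. G is a simple (X,M)-graph (distinct arcs have distinct parametrized incidences). -/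
open CategoryTheory

variable (M X : Type) [Monoid M]

variable {M X}

variable (M X)

variable {M X}

/-- An element `x : X` regarded as the morphism `x : V ⟶ A` of the theory. -/
def xArrow {M X : Type} [Monoid M] {ρ : RAction M X} (x : X) :
    theoryV ρ ⟶ theoryA ρ := x

/-- The parametrized incidence map `∂_G : G(A) → G(V)^X` of an `(X,M)`-graph `G`,
`∂_G(α)(x) = α.x = G(x)(α)`. -/
def incidence {M X : Type} [Monoid M] {ρ : RAction M X}
    (G : (GTheory M X ρ)ᵒᵖ ⥤ Type) (α : G.obj (Opposite.op (theoryA ρ))) :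
    X → G.obj (Opposite.op (theoryV ρ)) :=
  fun x => G.map (xArrow x).op α

/-- The sieve of all morphisms whose domain maps to the vertex object. -/
def vertexSieve {M X : Type} [Monoid M] {ρ : RAction M X} (c : GTheory M X ρ) : Sieve c where
  arrows Y _ := Nonempty (Y ⟶ theoryV ρ)
  downward_closed := fun ⟨h⟩ g => ⟨g ≫ h⟩

theorem vertexSieve_mem_dense {M X : Type} [Monoid M] [Nonempty X] {ρ : RAction M X}
    (c : GTheory M X ρ) : vertexSieve c ∈ GrothendieckTopology.dense c := by
  rintro (_ | _) f
  · exact ⟨theoryV ρ, 𝟙 _, ⟨𝟙 _⟩⟩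
  · obtain ⟨x⟩ := ‹Nonempty X›
    exact ⟨theoryV ρ, xArrow x, ⟨𝟙 _⟩⟩

/-- A sieve that covers for the dense topology contains every morphism out of the vertex object. -/
theorem mem_of_dense_of_vertex {M X : Type} [Monoid M] {ρ : RAction M X} {c : GTheory M X ρ}
    {S : Sieve c} (hS : S ∈ GrothendieckTopology.dense c) (f : theoryV ρ ⟶ c) :
    S.arrows f := by
  obtain ⟨_ | _, g, hg⟩ := hS f
  · have h : g ≫ f = f := Category.id_comp f
    rwa [h] at hg
  · exact PEmpty.elim g

/-- For a nonempty right `M`-set `X`, an `(X,M)`-graph `G` is a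
separated presheaf for the dense (double-negation) topology on `𝔾_{(X,M)}` —
where a sieve `S` on `c` covers iff every `f : d ⟶ c` admits some `g : e ⟶ d`
with `g ≫ f ∈ S` — if and only if the parametrized incidence map
`∂_G : G(A) → G(V)^X` is injective, i.e. `G` is simple. -/
theorem separated_for_dense_topology_iff_simple
    (M X : Type) [Monoid M] [Nonempty X] (ρ : RAction M X)
    (G : (GTheory M X ρ)ᵒᵖ ⥤ Type) :
    (∀ (c : GTheory M X ρ) (S : Sieve c),
        (∀ (d : GTheory M X ρ) (f : d ⟶ c),
          ∃ (e : GTheory M X ρ) (g : e ⟶ d), S.arrows (g ≫ f)) →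
        Presieve.IsSeparatedFor G S.arrows) ↔
      Function.Injective (incidence G) := by
  constructor
  · intro h α β hαβ
    refine (h (theoryA ρ) (vertexSieve _) fun _ f => vertexSieve_mem_dense _ f).ext ?_
    rintro (_ | _) f ⟨g⟩
    · exact congrFun hαβ f
    · exact PEmpty.elim g
  · rintro h (_ | _) S hS x t₁ t₂ h₁ h₂
    · have hid := mem_of_dense_of_vertex (fun f => hS _ f) (𝟙 (theoryV ρ))
      have map_id (t) : G.map (𝟙 (theoryV ρ)).op t = t := G.map_id_apply _ t
      exact (map_id t₁).symm.trans <| (h₁ _ hid).trans <| (h₂ _ hid).symm.trans (map_id t₂)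
    · refine h (funext fun y => ?_)
      have hy := mem_of_dense_of_vertex (fun f => hS _ f) (xArrow y)
      exact (h₁ _ hy).trans (h₂ _ hy).symm
end

section
/- Let X be a set with at least two elements. The category of power graphs 𝒢_{Π̲_X} = Set ↓ Π̲_X has binary products, but the single-edge object I(A) = (1, X, q) (one edge whose incidence is the class [id_X] ∈ Π̲_X(X)) is not exponentiable: the functor − × I(A) : 𝒢_{Π̲_X} ⥤ 𝒢_{Π̲_X} has no right adjoint. In particular 𝒢_{Π̲_X} is not cartesian closed. -/
open CategoryTheory

/-- Two functions `X → Y` are related iff they differ by precomposition with a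
permutation of `X`. -/
def symRel (X Y : Type) (f g : X → Y) : Prop := ∃ σ : Equiv.Perm X, f ∘ σ = g

/-- The setoid on `Y^X` whose quotient is the symmetric `X`-power. -/
def symSetoid (X Y : Type) : Setoid (X → Y) where
  r := symRel X Y
  iseqv := by
    constructor
    · intro f
      exact ⟨1, funext fun x => rfl⟩
    · rintro f g ⟨σ, hσ⟩
      refine ⟨σ⁻¹, funext fun x => ?_⟩
      have := congrFun hσ (σ⁻¹ x)
      simpa using this.symm
    · rintro f g h ⟨σ, hσ⟩ ⟨τ, hτ⟩
      refine ⟨τ.trans σ, funext fun x => ?_⟩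
      have h1 := congrFun hσ (τ x)
      have h2 := congrFun hτ x
      simpa using h1.trans h2

/-- The symmetric `X`-power `Π̲_X(Y)` of a set `Y`: the quotient of `Y^X` by
precomposition with permutations of `X`. -/
def SymPow (X Y : Type) : Type := Quotient (symSetoid X Y)

/-- The functorial action of `Π̲_X` on maps. -/
def SymPow.map {X Y Z : Type} (h : Y → Z) : SymPow X Y → SymPow X Z :=
  Quotient.map (fun f => h ∘ f)
    (by rintro f g ⟨σ, hσ⟩; exact ⟨σ, funext fun x => congrArg h (congrFun hσ x)⟩)

@[simp] lemma SymPow.map_mk {X Y Z : Type} (h : Y → Z) (f : X → Y) :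
    SymPow.map h (Quotient.mk (symSetoid X Y) f) =
      Quotient.mk (symSetoid X Z) (h ∘ f) := rfl

lemma SymPow.map_id {X Y : Type} (q : SymPow X Y) : SymPow.map id q = q :=
  Quotient.inductionOn q fun _ => rfl

lemma SymPow.map_map {X Y Z W : Type} (h : Y → Z) (k : Z → W) (q : SymPow X Y) :
    SymPow.map k (SymPow.map h q) = SymPow.map (k ∘ h) q :=
  Quotient.inductionOn q fun _ => rfl

/-- The category of power graphs `𝒢_{Π̲_X} = Set ↓ Π̲_X`: a set of edges, a set of
vertices, and an incidence map into the symmetric `X`-power of the vertices. -/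
structure PowerGraph (X : Type) : Type 1 where
  E : Type
  V : Type
  inc : E → SymPow X V

/-- Morphisms of power graphs. -/
@[ext]
structure PGHom {X : Type} (G H : PowerGraph X) where
  fE : G.E → H.E
  fV : G.V → H.V
  compat : ∀ e, H.inc (fE e) = SymPow.map fV (G.inc e)

instance (X : Type) : Category (PowerGraph X) where
  Hom := PGHom
  id G := ⟨id, id, fun e => (SymPow.map_id _).symm⟩
  comp f g := ⟨g.fE ∘ f.fE, g.fV ∘ f.fV, fun e => by
    simp only [Function.comp_apply, g.compat, f.compat, SymPow.map_map]⟩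
  id_comp f := rfl
  comp_id f := rfl
  assoc f g h := rfl

open Limits

/-- The single-edge power graph `I(A)`: one edge on vertex set `X`, with
incidence the class of `id : X → X`. -/
def IA (X : Type) : PowerGraph X :=
  ⟨PUnit, X, fun _ => Quotient.mk (symSetoid X X) id⟩

namespace PowerGraph

variable {X : Type}

@[ext]
lemma hom_ext {G H : PowerGraph X} {f g : G ⟶ H} (hE : f.fE = g.fE) (hV : f.fV = g.fV) :
    f = g :=
  PGHom.ext hE hV

/-- The binary product of power graphs: an edge is a pair of edges together with a joint
incidence lifting both incidences. -/
def prod (G H : PowerGraph X) : PowerGraph X where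
  E := {t : G.E × H.E × SymPow X (G.V × H.V) //
    G.inc t.1 = SymPow.map Prod.fst t.2.2 ∧ H.inc t.2.1 = SymPow.map Prod.snd t.2.2}
  V := G.V × H.V
  inc t := t.1.2.2

/-- The first projection of the binary product. -/
def prodFst (G H : PowerGraph X) : G.prod H ⟶ G :=
  PGHom.mk (fun t => t.1.1) Prod.fst fun t => t.2.1

/-- The second projection of the binary product. -/
def prodSnd (G H : PowerGraph X) : G.prod H ⟶ H :=
  PGHom.mk (fun t => t.1.2.1) Prod.snd fun t => t.2.2

/-- The pairing of two morphisms into a binary product. -/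
def prodLift {T G H : PowerGraph X} (f : T ⟶ G) (g : T ⟶ H) : T ⟶ G.prod H :=
  PGHom.mk
    (fun e => ⟨(f.fE e, g.fE e, SymPow.map (fun v => (f.fV v, g.fV v)) (T.inc e)), by
      rw [SymPow.map_map, SymPow.map_map]
      exact ⟨f.compat e, g.compat e⟩⟩)
    (fun v => (f.fV v, g.fV v)) fun _ => rfl

lemma prod_hom_ext {T G H : PowerGraph X} {m n : T ⟶ G.prod H}
    (h₁ : m ≫ prodFst G H = n ≫ prodFst G H) (h₂ : m ≫ prodSnd G H = n ≫ prodSnd G H) :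
    m = n := by
  have hV : m.fV = n.fV := funext fun v =>
    Prod.ext (congrFun (congrArg PGHom.fV h₁) v) (congrFun (congrArg PGHom.fV h₂) v)
  refine hom_ext (funext fun e => Subtype.ext (Prod.ext ?_ (Prod.ext ?_ ?_))) hV
  · exact congrFun (congrArg PGHom.fE h₁) e
  · exact congrFun (congrArg PGHom.fE h₂) e
  · exact (m.compat e).trans ((congrArg (SymPow.map · (T.inc e)) hV).trans (n.compat e).symm)

/-- The product cone is a limit. -/
def prodIsLimit (G H : PowerGraph X) : IsLimit (BinaryFan.mk (prodFst G H) (prodSnd G H)) :=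
  BinaryFan.IsLimit.mk _ (fun f g => prodLift f g) (fun _ _ => rfl) (fun _ _ => rfl)
    fun _ _ _ h₁ h₂ => prod_hom_ext h₁ h₂

instance : HasBinaryProducts (PowerGraph X) :=
  have (G H : PowerGraph X) : HasLimit (pair G H) := ⟨⟨_, prodIsLimit G H⟩⟩
  hasBinaryProducts_of_hasLimit_pair _

/-- The edge of `G` with incidence the class of `f`, seen as a morphism from `I(A)`. -/
def edgeHom {G : PowerGraph X} (e : G.E) (f : X → G.V)
    (h : G.inc e = Quotient.mk (symSetoid X G.V) f) : IA X ⟶ G :=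
  PGHom.mk (fun _ => e) f fun _ => h

/-- The automorphism of `I(A)` permuting the vertices. -/
def permHom (σ : Equiv.Perm X) : IA X ⟶ IA X :=
  edgeHom PUnit.unit σ (Quotient.sound ⟨σ, rfl⟩)

/-- The power graph with a single vertex and edge set `S`. -/
def bouquet (X S : Type) : PowerGraph X :=
  ⟨S, PUnit, fun _ => Quotient.mk (symSetoid X PUnit) fun _ => PUnit.unit⟩

lemma symPow_subsingleton {V : Type} [Subsingleton V] : Subsingleton (SymPow X V) := by
  refine ⟨fun a b => Quotient.inductionOn₂ a b fun f g => ?_⟩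
  rw [Subsingleton.elim f g]

/-- A morphism from a power graph into a bouquet is a map on edges. -/
def toBouquet {G : PowerGraph X} {S : Type} (φ : G.E → S) : G ⟶ bouquet X S :=
  PGHom.mk φ (fun _ => PUnit.unit) fun _ =>
    have : Subsingleton (bouquet X S).V := inferInstanceAs (Subsingleton PUnit)
    symPow_subsingleton.elim _ _

/-- Every edge of a power graph over `I(A)` is the image of a morphism from `I(A)` which is a
section of the structure map. -/
lemma exists_section {P : PowerGraph X} (q : P ⟶ IA X) (e : P.E) :
    ∃ u : IA X ⟶ P, u.fE PUnit.unit = e ∧ u ≫ q = 𝟙 (IA X) := by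
  obtain ⟨f, hf⟩ := Quotient.exists_rep (P.inc e)
  have h := q.compat e
  rw [← hf, SymPow.map_mk] at h
  obtain ⟨σ, hσ⟩ := Quotient.exact h.symm
  refine ⟨edgeHom e (f ∘ σ) (hf.symm.trans (Quotient.sound ⟨σ, rfl⟩)), rfl, ?_⟩
  exact hom_ext rfl hσ

/-- A product of `I(A)` with the one-edge bouquet has at most one edge. -/
lemma subsingleton_edges_of_isLimit_bouquet {P : PowerGraph X} {p : P ⟶ bouquet X PUnit}
    {q : P ⟶ IA X} (h : IsLimit (BinaryFan.mk p q)) : Subsingleton P.E := by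
  refine ⟨fun a b => ?_⟩
  obtain ⟨u, rfl, hu⟩ := exists_section q a
  obtain ⟨v, rfl, hv⟩ := exists_section q b
  rw [BinaryFan.IsLimit.hom_ext h (f := u) (g := v) (hom_ext rfl rfl) (hu.trans hv.symm)]

/-- A product of `I(A)` with itself has two distinct edges. -/
lemma nontrivial_edges_of_isLimit_IA [Nontrivial X] {P : PowerGraph X} {p q : P ⟶ IA X}
    (h : IsLimit (BinaryFan.mk p q)) : Nontrivial P.E := by
  obtain ⟨σ, hσ⟩ := exists_ne (1 : Equiv.Perm X)
  obtain ⟨u, hup, huq⟩ := BinaryFan.IsLimit.lift' h (𝟙 _) (𝟙 _)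
  obtain ⟨v, hvp, hvq⟩ := BinaryFan.IsLimit.lift' h (permHom σ) (𝟙 _)
  refine ⟨u.fE PUnit.unit, v.fE PUnit.unit, fun he => hσ (Equiv.ext fun x => ?_)⟩
  obtain ⟨τ, hτ⟩ := Quotient.exact
    ((u.compat PUnit.unit).symm.trans ((congrArg P.inc he).trans (v.compat PUnit.unit)))
  have hτx : u.fV (τ x) = v.fV x := congrFun hτ x
  have hτ_id : τ x = x :=
    (congrFun (congrArg PGHom.fV huq) (τ x)).symm.trans
      ((congrArg q.fV hτx).trans (congrFun (congrArg PGHom.fV hvq) x))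
  rw [hτ_id] at hτx
  exact (congrFun (congrArg PGHom.fV hvp) x).symm.trans
    ((congrArg p.fV hτx).symm.trans (congrFun (congrArg PGHom.fV hup) x))

/-- A right adjoint sends bouquets to power graphs with at most one vertex as soon as the left
adjoint sends the edgeless one-vertex graph to an edgeless graph. -/
lemma subsingleton_vertices_of_adjunction {F R : PowerGraph X ⥤ PowerGraph X} (adj : F ⊣ R)
    (hF : IsEmpty (F.obj (bouquet X Empty)).E) (S : Type) :
    Subsingleton (R.obj (bouquet X S)).V := by
  refine ⟨fun a b => ?_⟩
  let point (v : (R.obj (bouquet X S)).V) : bouquet X Empty ⟶ R.obj (bouquet X S) :=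
    PGHom.mk Empty.elim (fun _ => v) fun e => e.elim
  have h : point a = point b := (adj.homEquiv _ _).symm.injective
    (hom_ext (funext fun e => hF.elim e) rfl)
  exact congrFun (congrArg PGHom.fV h) PUnit.unit

/-- A morphism from `I(A)` to a power graph with at most one vertex factors through the one-edge
bouquet. -/
lemma exists_factor_bouquet [Nonempty X] {G : PowerGraph X} [Subsingleton G.V] (m : IA X ⟶ G) :
    ∃ n : bouquet X PUnit ⟶ G, toBouquet (fun _ => PUnit.unit) ≫ n = m := by
  obtain ⟨x⟩ := ‹Nonempty X›
  exact ⟨PGHom.mk m.fE (fun _ => m.fV x) fun _ => symPow_subsingleton.elim _ _,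
    hom_ext rfl (funext fun _ => Subsingleton.elim _ _)⟩

end PowerGraph

/-- For a set `X` with at least two elements, the category of
power graphs `𝒢_{Π̲_X}` has binary products, but the single-edge object `I(A)` is
not exponentiable: no functor computing the binary product with `I(A)` admits a
right adjoint.  In particular `𝒢_{Π̲_X}` is not cartesian closed. -/
theorem powerGraphs_products_but_IA_not_exponentiable (X : Type) [Nontrivial X] :
    HasBinaryProducts (PowerGraph X) ∧
      ∀ F : PowerGraph X ⥤ PowerGraph X,
        (∀ G : PowerGraph X, ∃ (p : F.obj G ⟶ G) (q : F.obj G ⟶ IA X),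
          Nonempty (IsLimit (BinaryFan.mk p q))) →
        ¬ F.IsLeftAdjoint := by
  refine ⟨inferInstance, fun F hF hadj => ?_⟩
  obtain ⟨R, ⟨adj⟩⟩ := hadj
  obtain ⟨pD, -, -⟩ := hF (PowerGraph.bouquet X Empty)
  obtain ⟨_, _, ⟨hL⟩⟩ := hF (PowerGraph.bouquet X PUnit)
  obtain ⟨_, _, ⟨hI⟩⟩ := hF (IA X)
  have := PowerGraph.subsingleton_edges_of_isLimit_bouquet hL
  obtain ⟨a, b, hab⟩ := PowerGraph.nontrivial_edges_of_isLimit_IA hI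
  have := PowerGraph.subsingleton_vertices_of_adjunction adj ⟨fun e => (pD.fE e).elim⟩
    (F.obj (IA X)).E
  obtain ⟨n, hn⟩ := PowerGraph.exists_factor_bouquet
    (adj.homEquiv _ _ (PowerGraph.toBouquet (id : (F.obj (IA X)).E → _)))
  have h := (adj.homEquiv_naturality_left_symm
    (PowerGraph.toBouquet (G := IA X) fun _ => PUnit.unit) n).symm
  rw [hn, Equiv.symm_apply_apply] at h
  have hE := congrFun (congrArg PGHom.fE h)
  exact hab ((hE a).symm.trans
    ((congrArg ((adj.homEquiv _ _).symm n).fE (Subsingleton.elim _ _)).trans (hE b)))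
end
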